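/- With the notation below, let G = Σ_{v ∈ S} c_v·u₁^{v₁}u₂^{v₂} ∈ ℂ[u₁,u₂] be non-degenerate with supp G ⊆ S ∖ {0}. Then the following are equivalent: (1) supp G contains a point of the ray ℝ≥0·(1,0) and a point of the ray ℝ≥0·(q,p) (i.e., the corresponding function g on X_σ has the form g = c₁·z₁^{p₁} + h + c_n·z_n^{p_n} with c₁, c_n ≠ 0); (2) there exists ε > 0 such that (a) for every (t₁,t₂) ∈ (ℂ∖{0})² with ‖φ(t₁,t₂)‖ < ε, the gradient (∂G/∂u₁(t₁,t₂), ∂G/∂u₂(t₁,t₂)) ≠ (0,0); (b) for every t ∈ ℂ∖{0} with |t| < ε, the derivative at t of the one-variable polynomial t ↦ G(t,0) is nonzero; and (c) for every s ∈ ℂ∖{0} with |s| < ε, the derivative at s of the one-variable polynomial s ↦ Σ_{k ≥ 1} c_{k·(q,p)}·s^k is nonzero. (Conditions (a)–(c) say exactly that the function determined by G on the toric surface X_σ has an isolated stratified singularity at the origin with respect to the orbit stratification.) -/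

import Mathlib

noncomputable section

open MvPolynomial

/-- Hirzebruch–Jung continued fraction value of a list of integers:
`HJ [a₂, …, a_k] = a₂ − 1/(a₃ − 1/(⋯ − 1/a_k))`. -/
def HJ : List ℤ → ℚ
  | [] => 0
  | [a] => (a : ℚ)
  | a :: b :: rest => (a : ℚ) - 1 / HJ (b :: rest)

/-- The Newton polygon `Γ₊(G)` of `G` relative to the dual cone
`σ̌ = {(y₁,y₂) : p·y₁ − q·y₂ ≥ 0, y₂ ≥ 0}`: the convex hull of
`⋃_{v ∈ supp G} (v + σ̌)`. -/
def NewtonPolygonDual (p q : ℕ) (G : MvPolynomial (Fin 2) ℂ) : Set (Fin 2 → ℝ) :=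
  convexHull ℝ {x | ∃ m ∈ G.support, ∃ y : Fin 2 → ℝ,
    (0 ≤ (p : ℝ) * y 0 - (q : ℝ) * y 1 ∧ 0 ≤ y 1) ∧ x = (fun i => (m i : ℝ)) + y}

open Classical in
/-- The face part `G_γ = Σ_{v ∈ γ ∩ S} c_v u^v` of `G` along a face `γ`. -/
def facePart (G : MvPolynomial (Fin 2) ℂ) (γ : Set (Fin 2 → ℝ)) :
    MvPolynomial (Fin 2) ℂ :=
  ∑ m ∈ G.support, if (fun i => (m i : ℝ)) ∈ γ then monomial m (coeff m G) else 0

/-- `G` is non-degenerate (relative to `σ̌`) if for every nonempty compact exposed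
face `γ` of its Newton polygon there is no point of the torus `(ℂ∖{0})²` where `G_γ`
and both its partial derivatives vanish. -/
def NonDegenerateDual (p q : ℕ) (G : MvPolynomial (Fin 2) ℂ) : Prop :=
  ∀ γ : Set (Fin 2 → ℝ), IsExposed ℝ (NewtonPolygonDual p q G) γ → IsCompact γ →
    γ.Nonempty →
    ¬ ∃ x : Fin 2 → ℂ, (∀ i, x i ≠ 0) ∧ eval x (facePart G γ) = 0 ∧
      ∀ i, eval x (pderiv i (facePart G γ)) = 0

/-- The value of a Hirzebruch–Jung continued fraction as a reduced fraction `P / Q`, together with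
the expression of the last term of the associated recursive sequence through `P` and `Q`. -/
theorem HJ_eq_div_and_last (l : List ℤ) (hl : l ≠ []) (h2 : ∀ x ∈ l, 2 ≤ x) :
    ∃ P Q : ℤ, 0 < Q ∧ Q < P ∧ IsCoprime P Q ∧ HJ l = (P : ℚ) / Q ∧
      ∀ u : ℕ → ℤ × ℤ,
        (∀ (i : ℕ) (hi : i < l.length), u (i + 2) = l[i] • u (i + 1) - u i) →
        u (l.length + 1) = P • u 1 - Q • u 0 := by
  induction l with
  | nil => exact absurd rfl hl
  | cons b l ih =>
    have hb : 2 ≤ b := h2 b (by simp)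
    cases l with
    | nil =>
      refine ⟨b, 1, by norm_num, by omega, isCoprime_one_right, by simp [HJ], fun u hu => ?_⟩
      simpa using hu 0 (by simp)
    | cons c l =>
      obtain ⟨P, Q, hQ, hQP, hco, hval, hu⟩ := ih (by simp) (fun x hx => h2 x (by simp [hx]))
      refine ⟨b * P - Q, P, by omega, by nlinarith, ?_, ?_, fun u h => ?_⟩
      · obtain ⟨x, y, hxy⟩ := hco
        exact ⟨-y, x + y * b, by linear_combination hxy⟩
      · have hP0 : (P : ℚ) ≠ 0 := by exact_mod_cast (by omega : P ≠ 0)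
        simp only [HJ, hval]
        push_cast
        field_simp
      · have h1 := hu (fun i => u (i + 1)) fun i hi =>
          h (i + 1) (Nat.succ_lt_succ hi)
        have h0 := h 0 (by simp)
        simp only [List.length_cons, zero_add, List.getElem_cons_zero] at h1 h0 ⊢
        rw [h1, h0, smul_sub, sub_smul, mul_comm, mul_smul]
        abel

/-- The last minimal generator of the dual semigroup is `(q, p)`. -/
theorem last_generator_eq (p q : ℕ) (hqp : q < p) (hcop : Nat.Coprime p q)
    (n : ℕ) (hn : 3 ≤ n) (a : ℕ → ℕ) (ha : ∀ i, 2 ≤ i → i ≤ n - 1 → 2 ≤ a i)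
    (hHJ : HJ ((List.range (n - 2)).map fun k => (a (k + 2) : ℤ))
      = (p : ℚ) / ((p : ℚ) - (q : ℚ)))
    (μ : ℕ → ℤ × ℤ) (hμ1 : μ 1 = (1, 0)) (hμ2 : μ 2 = (1, 1))
    (hrec : ∀ i, 2 ≤ i → i ≤ n - 1 → μ (i + 1) = (a i : ℤ) • μ i - μ (i - 1)) :
    μ n = ((q : ℤ), (p : ℤ)) := by
  obtain ⟨P, Q, hQ, hQP, hco, hval, hu⟩ :=
    HJ_eq_div_and_last ((List.range (n - 2)).map fun k => (a (k + 2) : ℤ))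
      (by simp only [ne_eq, List.map_eq_nil_iff, List.range_eq_nil]; omega)
      (by
        intro x hx
        obtain ⟨k, hk, rfl⟩ := List.mem_map.1 hx
        have := ha (k + 2) (by omega) (by have := List.mem_range.1 hk; omega)
        exact_mod_cast this)
  have hlast := hu (fun i => μ (i + 1)) fun i hi => by
    simp only [List.length_map, List.length_range] at hi
    simpa using hrec (i + 2) (by omega) (by omega)
  have hidx : n - 2 + 1 + 1 = n := by omega
  simp only [List.length_map, List.length_range, hidx, hμ1, hμ2, zero_add,
    Nat.reduceAdd] at hlast
  have hcop' : Nat.Coprime (p : ℤ).natAbs ((p : ℤ) - q).natAbs := by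
    rw [← Int.isCoprime_iff_nat_coprime]
    have h : IsCoprime (p : ℤ) (q : ℤ) := Nat.isCoprime_iff_coprime.2 hcop
    obtain ⟨x, y, hxy⟩ := h
    exact ⟨x + y, -y, by linear_combination hxy⟩
  have hfrac : ((P : ℤ) : ℚ) / (Q : ℤ) = ((p : ℤ) : ℚ) / ((p : ℤ) - q : ℤ) := by
    rw [← hval, hHJ]
    push_cast
    rfl
  obtain ⟨h1, h2⟩ := Rat.div_int_inj hQ (by omega) (Int.isCoprime_iff_nat_coprime.1 hco)
    hcop' hfrac
  rw [hlast]
  ext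
  · simp [h1, h2]
  · simp [h1]

open Filter Topology in
/-- A nonconstant polynomial has no critical points in a punctured neighbourhood of `0`. -/
theorem exists_pos_forall_deriv_ne_zero (P : Polynomial ℂ) (k : ℕ) (hk : k ≠ 0)
    (hP : P.coeff k ≠ 0) :
    ∃ ε > (0 : ℝ), ∀ t : ℂ, t ≠ 0 → ‖t‖ < ε → deriv (fun z => P.eval z) t ≠ 0 := by
  have hd : P.derivative ≠ 0 := fun h => by
    have := congrArg (fun R => Polynomial.coeff R (k - 1)) h
    simp only [Polynomial.coeff_derivative, Polynomial.coeff_zero] at this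
    rw [show k - 1 + 1 = k by omega] at this
    refine mul_ne_zero hP ?_ this
    exact_mod_cast Nat.succ_ne_zero (k - 1)
  have hfin : ({z | P.derivative.IsRoot z} \ {0} : Set ℂ).Finite :=
    (Polynomial.finite_setOfPred_isRoot hd).subset Set.sdiff_subset
  obtain ⟨ε, hε, h⟩ := Metric.mem_nhds_iff.1
    (hfin.isClosed.isOpen_compl.mem_nhds (by simp : (0 : ℂ) ∈ ({z | P.derivative.IsRoot z} \ {0})ᶜ))
  refine ⟨ε, hε, fun t ht hlt h0 => h (by simpa using hlt) ⟨?_, by simpa using ht⟩⟩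
  rwa [Polynomial.deriv] at h0

theorem facePart_eq_sum_filter (G : MvPolynomial (Fin 2) ℂ) (γ : Set (Fin 2 → ℝ))
    (s : Finset (Fin 2 →₀ ℕ)) (hs : s ⊆ G.support)
    (h : ∀ m ∈ G.support, (fun i => (m i : ℝ)) ∈ γ ↔ m ∈ s) :
    facePart G γ = ∑ m ∈ s, monomial m (coeff m G) := by
  classical
  rw [facePart, ← Finset.sum_filter]
  congr 1
  ext m
  simp only [Finset.mem_filter]
  exact ⟨fun hm => (h m hm.1).1 hm.2, fun hm => ⟨hs hm, (h m (hs hm)).2 hm⟩⟩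

theorem mul_eval_pderiv_sum_monomial (s : Finset (Fin 2 →₀ ℕ)) (c : (Fin 2 →₀ ℕ) → ℂ)
    (x : Fin 2 → ℂ) (i : Fin 2) :
    x i * eval x (pderiv i (∑ m ∈ s, monomial m (c m))) =
      ∑ m ∈ s, c m * m i * (x 0 ^ m 0 * x 1 ^ m 1) := by
  rw [map_sum, map_sum, Finset.mul_sum]
  refine Finset.sum_congr rfl fun m _ => ?_
  rw [pderiv_monomial, eval_monomial, Finsupp.prod_fintype _ _ (by simp), Fin.prod_univ_two]
  rcases Nat.eq_zero_or_pos (m i) with h0 | h0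
  · simp [h0]
  · obtain ⟨k, hk⟩ := Nat.exists_eq_succ_of_ne_zero h0.ne'
    fin_cases i <;> simp at hk ⊢ <;> simp [hk, pow_succ] <;> ring

/-- The face of the Newton polygon exposed by a weight `(1, w)` in the interior of the cone is
the convex hull of the exponents of minimal weight. -/
theorem mem_convexHull_of_mem_NewtonPolygonDual (p q : ℕ) (hp : 0 < p)
    (G : MvPolynomial (Fin 2) ℂ) (w δ : ℝ) (hw : 0 < q + p * w)
    (hmin : ∀ m ∈ G.support, δ ≤ m 0 + w * m 1) (x : Fin 2 → ℝ)
    (hx : x ∈ NewtonPolygonDual p q G) :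
    δ < x 0 + w * x 1 ∨
      (x ∈ convexHull ℝ ((fun (m : Fin 2 →₀ ℕ) i => (m i : ℝ)) ''
        {m | m ∈ G.support ∧ (m 0 : ℝ) + w * m 1 = δ})) := by
  set A : Set (Fin 2 → ℝ) := (fun (m : Fin 2 →₀ ℕ) i => (m i : ℝ)) ''
        {m | m ∈ G.support ∧ (m 0 : ℝ) + w * m 1 = δ} with hA
  have hp' : (0 : ℝ) < p := by exact_mod_cast hp
  have hAδ : ∀ y ∈ convexHull ℝ A, δ ≤ y 0 + w * y 1 := by
    intro y hy
    have hcv : Convex ℝ {y : Fin 2 → ℝ | δ ≤ y 0 + w * y 1} := by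
      intro y hy z hz a b ha hb hab
      simp only [Set.mem_ofPred_eq, Pi.add_apply, Pi.smul_apply, smul_eq_mul] at hy hz ⊢
      obtain rfl : b = 1 - a := by linarith
      nlinarith [mul_le_mul_of_nonneg_left hy ha, mul_le_mul_of_nonneg_left hz hb]
    refine convexHull_min ?_ hcv hy
    rintro _ ⟨m, hm, rfl⟩
    exact hm.2.ge
  refine convexHull_min (t := {x | δ < x 0 + w * x 1 ∨ x ∈ convexHull ℝ A}) ?_ ?_ hx
  · rintro _ ⟨m, hm, y, ⟨hy1, hy2⟩, rfl⟩
    simp only [Set.mem_ofPred_eq, Pi.add_apply]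
    have hmd := hmin m hm
    have hpy : p * (y 0 + w * y 1) = (p * y 0 - q * y 1) + (q + p * w) * y 1 := by ring
    have hmul : 0 ≤ (q + p * w) * y 1 := mul_nonneg hw.le hy2
    by_cases hlt : δ < m 0 + y 0 + w * (m 1 + y 1)
    · exact Or.inl hlt
    · right
      have hle : p * (y 0 + w * y 1) ≤ 0 :=
        mul_nonpos_of_nonneg_of_nonpos hp'.le (by linarith)
      have h1 : y 1 = 0 := by
        rcases mul_eq_zero.1 (le_antisymm (by linarith) hmul) with h | h
        · exact absurd h hw.ne'
        · exact h
      have h0 : y 0 = 0 := by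
        rw [h1] at hy1 hle
        refine le_antisymm ?_ ?_ <;> by_contra! h <;> nlinarith
      refine subset_convexHull ℝ A ⟨m, ⟨hm, ?_⟩, ?_⟩
      · rw [h0, h1] at hlt
        linarith
      · ext i
        fin_cases i <;> simp [h0, h1]
  · rw [convex_iff_forall_pos]
    intro y hy z hz a b ha hb hab
    by_cases h : y ∈ convexHull ℝ A ∧ z ∈ convexHull ℝ A
    · exact Or.inr (convex_convexHull ℝ A h.1 h.2 ha.le hb.le hab)
    · left
      obtain rfl : b = 1 - a := by linarith
      simp only [Set.mem_ofPred_eq, Pi.add_apply, Pi.smul_apply, smul_eq_mul] at hy hz ⊢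
      have key : ∀ u : Fin 2 → ℝ, (δ < u 0 + w * u 1 ∨ u ∈ convexHull ℝ A) →
          δ ≤ u 0 + w * u 1 := fun u hu => hu.elim le_of_lt (hAδ u)
      rcases not_and_or.1 h with h | h
      · nlinarith [mul_lt_mul_of_pos_left (hy.resolve_right h) ha,
          mul_le_mul_of_nonneg_left (key z hz) hb.le]
      · nlinarith [mul_lt_mul_of_pos_left (hz.resolve_right h) hb,
          mul_le_mul_of_nonneg_left (key y hy) ha.le]

/-- The weight of a nonzero exponent in the dual cone is positive. -/
theorem weight_pos (p q : ℕ) (hp : 0 < p) (w : ℝ) (hw : 0 < q + p * w)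
    (m : Fin 2 →₀ ℕ) (hm : 0 ≤ (p : ℤ) * (m 0 : ℤ) - (q : ℤ) * (m 1 : ℤ)) (h0 : m ≠ 0) :
    0 < (m 0 : ℝ) + w * m 1 := by
  have hp' : (0 : ℝ) < p := by exact_mod_cast hp
  have hm' : (0 : ℝ) ≤ p * m 0 - q * m 1 := by exact_mod_cast hm
  have h1 : (0 : ℝ) ≤ m 1 := Nat.cast_nonneg _
  refine (mul_pos_iff_of_pos_left hp').1 ?_
  rw [show (p : ℝ) * (m 0 + w * m 1) = (p * m 0 - q * m 1) + (q + p * w) * m 1 by ring]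
  rcases Nat.eq_zero_or_pos (m 1) with h | h
  · have : 0 < m 0 := by
      by_contra h'
      refine h0 (Finsupp.ext fun i => ?_)
      fin_cases i
      · simpa using h'
      · simpa using h
    have : (0 : ℝ) < m 0 := by exact_mod_cast this
    simp only [h, Nat.cast_zero, mul_zero, sub_zero, add_zero]
    positivity
  · have : (0 : ℝ) < m 1 := by exact_mod_cast h
    have := mul_pos hw this
    linarith

/-- For a nondegenerate `G`, the logarithmic gradient of the part of `G` of minimal weight
has no zeros on the torus, for any weight `(1, w)` in the interior of the cone. -/
theorem NonDegenerateDual.exists_logGradient_ne_zero {p q : ℕ} (hp : 0 < p)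
    {G : MvPolynomial (Fin 2) ℂ} (hG : NonDegenerateDual p q G)
    (hsupp : ∀ m ∈ G.support,
      0 ≤ (p : ℤ) * (m 0 : ℤ) - (q : ℤ) * (m 1 : ℤ) ∧ m ≠ 0)
    (w : ℝ) (hw : 0 < q + p * w) (m₀ : Fin 2 →₀ ℕ) (hm₀ : m₀ ∈ G.support)
    (hmin : ∀ m ∈ G.support, (m₀ 0 : ℝ) + w * m₀ 1 ≤ m 0 + w * m 1)
    (x : Fin 2 → ℂ) (hx : ∀ i, x i ≠ 0) :
    ∃ i, ∑ m ∈ G.support with (m 0 : ℝ) + w * m 1 = m₀ 0 + w * m₀ 1,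
      coeff m G * m i * (x 0 ^ m 0 * x 1 ^ m 1) ≠ 0 := by
  classical
  by_contra! hcrit
  set δ : ℝ := m₀ 0 + w * m₀ 1 with hδ
  set s := G.support.filter fun m => (m 0 : ℝ) + w * m 1 = δ with hs
  have hδpos : 0 < δ := weight_pos p q hp w hw m₀ (hsupp m₀ hm₀).1 (hsupp m₀ hm₀).2
  let l : StrongDual ℝ (Fin 2 → ℝ) :=
    -(ContinuousLinearMap.proj 0 + w • ContinuousLinearMap.proj 1)
  have hl : ∀ y, l y = -(y 0 + w * y 1) := fun y => by simp [l]
  set ι : (Fin 2 →₀ ℕ) → Fin 2 → ℝ := fun m i => (m i : ℝ) with hι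
  have hmemN : ∀ m ∈ G.support, ι m ∈ NewtonPolygonDual p q G := fun m hm =>
    subset_convexHull ℝ _ ⟨m, hm, 0, by simp, by simp [hι]⟩
  set A : Set (Fin 2 → ℝ) := ι '' {m | m ∈ G.support ∧ (m 0 : ℝ) + w * m 1 = δ} with hA
  have hface := mem_convexHull_of_mem_NewtonPolygonDual p q hp G w δ hw hmin
  have hAδ : ∀ y ∈ convexHull ℝ A, y 0 + w * y 1 = δ := by
    intro y hy
    have hcv : Convex ℝ {y : Fin 2 → ℝ | y 0 + w * y 1 = δ} := by
      intro y hy z hz a b ha hb hab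
      simp only [Set.mem_ofPred_eq, Pi.add_apply, Pi.smul_apply, smul_eq_mul] at hy hz ⊢
      linear_combination a * hy + b * hz + δ * hab
    refine convexHull_min ?_ hcv hy
    rintro _ ⟨m, hm, rfl⟩
    exact hm.2
  have hNδ : ∀ y ∈ NewtonPolygonDual p q G, δ ≤ y 0 + w * y 1 := fun y hy =>
    (hface y hy).elim le_of_lt fun h => (hAδ y h).ge
  set γ : Set (Fin 2 → ℝ) :=
    {y | y ∈ NewtonPolygonDual p q G ∧ ∀ z ∈ NewtonPolygonDual p q G, l z ≤ l y} with hγ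
  have hmem : ∀ y, y ∈ γ ↔ y ∈ NewtonPolygonDual p q G ∧ y 0 + w * y 1 = δ := by
    refine fun y => and_congr_right fun hy => ⟨fun h => ?_, fun h z hz => ?_⟩
    · have := h _ (hmemN m₀ hm₀)
      rw [hl, hl] at this
      exact le_antisymm (by simp only [hι] at this; linarith) (hNδ y hy)
    · rw [hl, hl]
      linarith [hNδ z hz]
  have hγA : γ = convexHull ℝ A := by
    ext y
    rw [hmem]
    refine ⟨fun h => (hface y h.1).resolve_left h.2.not_gt, fun h => ⟨?_, hAδ y h⟩⟩
    refine convexHull_min ?_ (convex_convexHull ℝ _) h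
    rintro _ ⟨m, hm, rfl⟩
    exact hmemN m hm.1
  have hcomp : IsCompact γ := by
    rw [hγA]
    exact (((Finset.finite_toSet G.support).subset fun m hm => hm.1).image ι).isCompact_convexHull
      (𝕜 := ℝ)
  have hpart : facePart G γ = ∑ m ∈ s, monomial m (coeff m G) :=
    facePart_eq_sum_filter G γ s (Finset.filter_subset _ _) fun m hm => by
      rw [hmem, hs, Finset.mem_filter]
      exact ⟨fun h => ⟨hm, h.2⟩, fun h => ⟨hmemN m hm, h.2⟩⟩
  refine hG γ (fun _ => ⟨l, rfl⟩) hcomp ⟨ι m₀, (hmem _).2 ⟨hmemN m₀ hm₀, rfl⟩⟩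
    ⟨x, hx, ?_, fun i => ?_⟩
  · have heuler : (δ : ℂ) * eval x (facePart G γ) =
        (∑ m ∈ s, coeff m G * m 0 * (x 0 ^ m 0 * x 1 ^ m 1)) +
        w * ∑ m ∈ s, coeff m G * m 1 * (x 0 ^ m 0 * x 1 ^ m 1) := by
      rw [hpart, map_sum, Finset.mul_sum, Finset.mul_sum, ← Finset.sum_add_distrib]
      refine Finset.sum_congr rfl fun m hm => ?_
      have hmδ : (m 0 : ℂ) + w * m 1 = δ := by exact_mod_cast (Finset.mem_filter.1 hm).2
      rw [eval_monomial, Finsupp.prod_fintype _ _ (by simp), Fin.prod_univ_two, ← hmδ]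
      ring
    rw [hcrit 0, hcrit 1, mul_zero, add_zero] at heuler
    exact (mul_eq_zero.1 heuler).resolve_left (by exact_mod_cast hδpos.ne')
  · have h := mul_eval_pderiv_sum_monomial s (fun m => coeff m G) x i
    rw [hcrit i, ← hpart] at h
    exact (mul_eq_zero.1 h).resolve_left (hx i)

open Filter Topology in
/-- Let `u, v` be real functions along a filter such that `u` and `q u + p v` tend to infinity
while a nontrivial linear combination of `u, v` stays bounded: then `v - w u` is bounded for a
slope `w` such that `(1, w)` is in the interior of the cone. -/
theorem exists_slope_of_bounded_combination {ι : Type*} {U : Filter ι} [U.NeBot] {p q : ℕ}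
    {u v : ι → ℝ} (hu : Tendsto u U atTop)
    (huv : Tendsto (fun n => q * u n + p * v n) U atTop) {d e B : ℝ} (hde : d ≠ 0 ∨ e ≠ 0)
    (hB : ∀ᶠ n in U, |d * u n + e * v n| ≤ B) :
    ∃ w C : ℝ, 0 < q + p * w ∧ ∀ᶠ n in U, |v n - w * u n| ≤ C := by
  have he : e ≠ 0 := by
    rintro rfl
    have hd : d ≠ 0 := hde.resolve_right (by simp)
    obtain ⟨n, h1, h2⟩ := ((hu.eventually_gt_atTop (B / |d|)).and hB).exists
    have hd' : 0 < |d| := abs_pos.2 hd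
    rw [zero_mul, add_zero, abs_mul] at h2
    rw [div_lt_iff₀ hd'] at h1
    nlinarith [le_abs_self (u n)]
  have hC : ∀ᶠ n in U, |v n - -d / e * u n| ≤ B / |e| := by
    filter_upwards [hB] with n hn
    have h : (v n - -d / e * u n) * e = d * u n + e * v n := by
      field_simp
      ring
    rwa [le_div_iff₀ (abs_pos.2 he), ← abs_mul, h]
  refine ⟨-d / e, B / |e|, ?_, hC⟩
  by_contra! hneg
  obtain ⟨n, h1, h2, h3⟩ := ((huv.eventually_gt_atTop (p * (B / |e|))).and
    (hC.and (hu.eventually_ge_atTop 0))).exists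
  have hp : (0 : ℝ) ≤ p := Nat.cast_nonneg _
  have h4 := mul_le_mul_of_nonneg_left ((le_abs_self _).trans h2) hp
  have h5 := mul_nonpos_of_nonpos_of_nonneg hneg h3
  linarith

open Filter Topology in
/-- A nondegenerate `G` which is nonzero has no sequence of critical points on the torus along
which both extremal monomials tend to zero. -/
theorem NonDegenerateDual.eq_zero_of_tendsto_critical {p q : ℕ} (hp : 0 < p)
    {G : MvPolynomial (Fin 2) ℂ} (hG : NonDegenerateDual p q G)
    (hsupp : ∀ m ∈ G.support,
      0 ≤ (p : ℤ) * (m 0 : ℤ) - (q : ℤ) * (m 1 : ℤ) ∧ m ≠ 0)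
    {ι : Type*} (U : Ultrafilter ι) (s t : ι → ℂ) (hs : ∀ n, s n ≠ 0) (ht : ∀ n, t n ≠ 0)
    (hs0 : Tendsto s U (𝓝 0)) (hst0 : Tendsto (fun n => s n ^ q * t n ^ p) U (𝓝 0))
    (hcrit : ∀ n i, eval ![s n, t n] (pderiv i G) = 0) : G = 0 := by
  classical
  by_contra hG0
  have hne : G.support.Nonempty := support_nonempty.2 hG0
  set u : ι → ℝ := fun n => -Real.log ‖s n‖ with hu_def
  set v : ι → ℝ := fun n => -Real.log ‖t n‖ with hv_def
  have hlog : ∀ f : ι → ℂ, (∀ n, f n ≠ 0) → Tendsto f U (𝓝 0) →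
      Tendsto (fun n => -Real.log ‖f n‖) U atTop := fun f hf h => by
    refine tendsto_neg_atBot_atTop.comp (Real.tendsto_log_nhdsGT_zero.comp ?_)
    exact tendsto_nhdsWithin_iff.2 ⟨by simpa using h.norm, .of_forall fun n => norm_pos_iff.2 (hf n)⟩
  have hu : Tendsto u U atTop := hlog s hs hs0
  have huv : Tendsto (fun n => q * u n + p * v n) U atTop := by
    refine (hlog _ (fun n => mul_ne_zero (pow_ne_zero _ (hs n)) (pow_ne_zero _ (ht n)))
      hst0).congr fun n => ?_
    rw [norm_mul, norm_pow, norm_pow, Real.log_mul (by simp [hs n]) (by simp [ht n]),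
      Real.log_pow, Real.log_pow]
    simp only [hu_def, hv_def]
    ring
  set M : (Fin 2 →₀ ℕ) → ι → ℂ := fun m n => s n ^ m 0 * t n ^ m 1 with hM
  have hM0 : ∀ m n, M m n ≠ 0 := fun m n =>
    mul_ne_zero (pow_ne_zero _ (hs n)) (pow_ne_zero _ (ht n))
  set W : (Fin 2 →₀ ℕ) → ι → ℝ := fun m n => m 0 * u n + m 1 * v n with hW
  have hMW : ∀ m n, ‖M m n‖ = Real.exp (-W m n) := fun m n => by
    rw [← Real.exp_log (norm_pos_iff.2 (hM0 m n))]
    congr 1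
    simp only [hM, hW, hu_def, hv_def]
    rw [norm_mul, norm_pow, norm_pow, Real.log_mul (by simp [hs n]) (by simp [ht n]),
      Real.log_pow, Real.log_pow]
    ring
  obtain ⟨m₀, hm₀, hmin⟩ : ∃ m₀ ∈ G.support, ∀ᶠ n in U, ∀ m ∈ G.support, W m₀ n ≤ W m n :=
    (Ultrafilter.eventually_exists_mem_iff (Finset.finite_toSet G.support)).1 <|
      .of_forall fun n => Finset.exists_min_image G.support (fun m => W m n) hne
  have hquot : ∀ m, Tendsto (fun n => W m n - W m₀ n) U atTop →
      Tendsto (fun n => M m n / M m₀ n) U (𝓝 0) := fun m h => by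
    rw [tendsto_zero_iff_norm_tendsto_zero]
    refine (Real.tendsto_exp_atBot.comp (tendsto_neg_atTop_atBot.comp h)).congr fun n => ?_
    rw [norm_div, hMW, hMW, ← Real.exp_sub]
    simp only [Function.comp]
    congr 1
    ring
  have hgrad : ∀ i n, ∑ m ∈ G.support, coeff m G * m i * (M m n / M m₀ n) = 0 := fun i n => by
    have h := mul_eval_pderiv_sum_monomial G.support (fun m => coeff m G) ![s n, t n] i
    rw [support_sum_monomial_coeff, hcrit, mul_zero] at h
    simp only [Matrix.cons_val_zero, Matrix.cons_val_one] at h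
    simp_rw [← mul_div_assoc, ← Finset.sum_div, hM, ← h, zero_div]
  have hlim : ∀ (r : (Fin 2 →₀ ℕ) → ℂ),
      (∀ m ∈ G.support, Tendsto (fun n => M m n / M m₀ n) U (𝓝 (r m))) →
      ∀ i, ∑ m ∈ G.support, coeff m G * m i * r m = 0 := fun r hr i =>
    tendsto_nhds_unique
      ((tendsto_finsetSum G.support fun m hm => (hr m hm).const_mul (coeff m G * (m i : ℂ))))
      (by simp_rw [hgrad]; exact tendsto_const_nhds)
  by_cases hdom : ∀ m ∈ G.support, m ≠ m₀ → Tendsto (fun n => W m n - W m₀ n) U atTop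
  · refine (hsupp m₀ hm₀).2 (Finsupp.ext fun i => ?_)
    have h := hlim (fun m => if m = m₀ then 1 else 0) (fun m hm => by
      split_ifs with h
      · subst h
        simp_rw [div_self (hM0 m _)]
        exact tendsto_const_nhds
      · exact hquot m (hdom m hm h)) i
    simp only [mul_ite, mul_one, mul_zero, Finset.sum_ite_eq', hm₀, if_true] at h
    simpa using (mul_eq_zero.1 h).resolve_left (mem_support_iff.1 hm₀)
  push Not at hdom
  obtain ⟨m₁, hm₁, hne₁, hnt⟩ := hdom
  obtain ⟨B, hB⟩ : ∃ B, ∀ᶠ n in U, W m₁ n - W m₀ n ≤ B := by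
    simp only [tendsto_atTop, not_forall] at hnt
    obtain ⟨B, hB⟩ := hnt
    exact ⟨B, (Ultrafilter.eventually_not.2 hB).mono fun n h => (not_le.1 h).le⟩
  obtain ⟨w, C, hw, hC⟩ := exists_slope_of_bounded_combination (p := p) (q := q) hu huv
    (d := (m₁ 0 : ℝ) - m₀ 0) (e := (m₁ 1 : ℝ) - m₀ 1) (B := B) (by
      by_contra! h
      refine hne₁ (Finsupp.ext fun i => ?_)
      fin_cases i
      · exact_mod_cast sub_eq_zero.1 h.1
      · exact_mod_cast sub_eq_zero.1 h.2) (by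
      filter_upwards [hB, hmin] with n h1 h2
      have h3 := h2 m₁ hm₁
      simp only [hW] at h1 h3
      rw [abs_le]
      constructor <;> linarith)
  have hWsub : ∀ m n, W m n - W m₀ n =
      (m 0 + w * m 1 - (m₀ 0 + w * m₀ 1)) * u n + (m 1 - m₀ 1) * (v n - w * u n) :=
    fun m n => by simp only [hW]; ring
  have hbdd : ∀ m : Fin 2 →₀ ℕ, ∀ᶠ n in U,
      |((m 1 : ℝ) - m₀ 1) * (v n - w * u n)| ≤ |(m 1 : ℝ) - m₀ 1| * C := fun m => by
    filter_upwards [hC] with n hn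
    rw [abs_mul]
    exact mul_le_mul_of_nonneg_left hn (abs_nonneg _)
  have hmin' : ∀ m ∈ G.support, (m₀ 0 : ℝ) + w * m₀ 1 ≤ m 0 + w * m 1 := fun m hm => by
    by_contra! hlt
    have hlt' : 0 < (m₀ 0 : ℝ) + w * m₀ 1 - (m 0 + w * m 1) := by linarith
    obtain ⟨n, h1, h2, h3⟩ := (((hu.const_mul_atTop hlt').eventually_gt_atTop
      (|(m 1 : ℝ) - m₀ 1| * C)).and ((hbdd m).and hmin)).exists
    have h4 := h3 m hm
    have h5 := hWsub m n
    have h6 := (abs_le.1 h2).2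
    linarith
  set y : ι → ℂ := fun n => Complex.exp (Complex.log (t n) - w * Complex.log (s n)) with hy
  have hynorm : ∀ n, ‖y n‖ = Real.exp (-(v n - w * u n)) := fun n => by
    rw [hy, Complex.norm_exp]
    congr 1
    simp only [Complex.sub_re, Complex.re_ofReal_mul, Complex.log_re, hu_def, hv_def]
    ring
  obtain ⟨y₀, hy₀, hylim⟩ : ∃ y₀ : ℂ, y₀ ≠ 0 ∧ Tendsto y U (𝓝 y₀) := by
    have hcpt : IsCompact (Metric.closedBall (0 : ℂ) (Real.exp C)) := isCompact_closedBall _ _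
    obtain ⟨y₀, -, h⟩ := hcpt.ultrafilter_le_nhds (U.map y) (by
      rw [le_principal_iff, Ultrafilter.mem_coe, Ultrafilter.mem_map, ← Ultrafilter.mem_coe]
      filter_upwards [hC] with n hn
      rw [Set.mem_preimage, mem_closedBall_zero_iff, hynorm, Real.exp_le_exp]
      linarith [(abs_le.1 hn).1])
    have hT : Tendsto y U (𝓝 y₀) := h
    refine ⟨y₀, ?_, hT⟩
    have : Real.exp (-C) ≤ ‖y₀‖ := ge_of_tendsto hT.norm (by
      filter_upwards [hC] with n hn
      rw [hynorm, Real.exp_le_exp]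
      linarith [(abs_le.1 hn).2])
    exact norm_pos_iff.1 ((Real.exp_pos _).trans_le this)
  have hMexp : ∀ m n, M m n = Complex.exp ((m 0 + w * m 1) * Complex.log (s n)) * y n ^ m 1 :=
    fun m n => by
      simp only [hM, hy]
      conv_lhs => rw [← Complex.exp_log (hs n), ← Complex.exp_log (ht n)]
      rw [← Complex.exp_nat_mul, ← Complex.exp_nat_mul, ← Complex.exp_nat_mul, ← Complex.exp_add,
        ← Complex.exp_add]
      congr 1
      ring
  obtain ⟨i, hi⟩ := hG.exists_logGradient_ne_zero hp hsupp w hw m₀ hm₀ hmin' ![1, y₀]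
    (by intro i; fin_cases i <;> simp [hy₀])
  refine hi ?_
  have h := hlim (fun m => if (m 0 : ℝ) + w * m 1 = m₀ 0 + w * m₀ 1 then
      y₀ ^ m 1 / y₀ ^ m₀ 1 else 0) (fun m hm => by
    split_ifs with h
    · refine ((hylim.pow (m 1)).div (hylim.pow (m₀ 1)) (pow_ne_zero _ hy₀)).congr fun n => ?_
      have h' : (m 0 : ℂ) + w * m 1 = m₀ 0 + w * m₀ 1 := by exact_mod_cast h
      rw [hMexp, hMexp, h', mul_div_mul_left _ _ (Complex.exp_ne_zero _)]
      rfl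
    · refine hquot m ?_
      have hpos : 0 < (m 0 : ℝ) + w * m 1 - (m₀ 0 + w * m₀ 1) :=
        sub_pos.2 (lt_of_le_of_ne (hmin' m hm) (Ne.symm h))
      simp_rw [hWsub]
      refine tendsto_atTop_add_right_of_le' _ (-(|(m 1 : ℝ) - m₀ 1| * C))
        (hu.const_mul_atTop hpos) ?_
      filter_upwards [hbdd m] with n hn
      exact (abs_le.1 hn).1) i
  simp only [mul_ite, mul_zero, ← Finset.sum_filter, ← mul_div_assoc, ← Finset.sum_div] at h
  have h' := (div_eq_zero_iff.1 h).resolve_right (pow_ne_zero _ hy₀)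
  simpa using h'

theorem coeff_aeval_X_zero {G : MvPolynomial (Fin 2) ℂ} (m : Fin 2 →₀ ℕ) (hm : m 1 = 0) :
    (aeval ![Polynomial.X, (0 : Polynomial ℂ)] G).coeff (m 0) = coeff m G := by
  classical
  rw [aeval_def, eval₂_eq', Polynomial.finsetSum_coeff]
  have hterm : ∀ d ∈ G.support, (algebraMap ℂ (Polynomial ℂ) (coeff d G) *
      ∏ i, (![Polynomial.X, (0 : Polynomial ℂ)] i) ^ d i).coeff (m 0) =
        if d = m then coeff d G else 0 := by
    intro d _
    rw [Fin.prod_univ_two, Polynomial.algebraMap_eq, Polynomial.coeff_C_mul]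
    split_ifs with h
    · subst h
      simp [hm]
    · by_cases h1 : d 1 = 0
      · have h0 : m 0 ≠ d 0 := fun h0 => h (by
          ext i
          fin_cases i
          · exact h0.symm
          · exact h1.trans hm.symm)
        simp [h1, Polynomial.coeff_X_pow, h0]
      · simp [h1]
  rw [Finset.sum_congr rfl hterm, Finset.sum_ite_eq']
  split_ifs with h
  · rfl
  · exact (notMem_support_iff.1 h).symm

theorem eval_aeval_X_zero (G : MvPolynomial (Fin 2) ℂ) (z : ℂ) :
    (aeval ![Polynomial.X, (0 : Polynomial ℂ)] G).eval z = eval ![z, (0 : ℂ)] G := by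
  rw [aeval_def, eval₂_eq', eval_eq', Polynomial.eval_finsetSum]
  simp [Fin.prod_univ_two]

/-- Characterization of the non-degenerate functions `G` on the toric surface `X_σ`
(for `σ` with dual semigroup `S` generated by `μ₁ = (1,0), …, μ_n = (q,p)`) having an
isolated stratified singularity at the origin: `supp G` meets both rays
`ℝ≥0·(1,0)` and `ℝ≥0·(q,p)` (i.e. `g = c₁z₁^{p₁} + h + c_nz_n^{p_n}`) if and only if,
for some `ε > 0`, (a) the restriction of `G` to the open torus orbit
`φ((ℂ∖{0})²)`, (b) the restriction `t ↦ G(t,0)` to the orbit `T_{Δ₁}`, and (c) the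
restriction `s ↦ Σ_{k≥1} c_{k(q,p)} s^k` to the orbit `T_{Δ₂}` have no critical
points within distance `ε` of the origin. -/
theorem isolated_singularity_iff_supp_meets_rays
    (p q : ℕ) (hq : 0 < q) (hqp : q < p) (hcop : Nat.Coprime p q)
    (n : ℕ) (hn : 3 ≤ n) (a : ℕ → ℕ)
    (ha : ∀ i, 2 ≤ i → i ≤ n - 1 → 2 ≤ a i)
    (hHJ : HJ ((List.range (n - 2)).map fun k => (a (k + 2) : ℤ))
      = (p : ℚ) / ((p : ℚ) - (q : ℚ)))
    (μ : ℕ → ℤ × ℤ) (hμ1 : μ 1 = (1, 0)) (hμ2 : μ 2 = (1, 1))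
    (hrec : ∀ i, 2 ≤ i → i ≤ n - 1 → μ (i + 1) = (a i : ℤ) • μ i - μ (i - 1))
    (G : MvPolynomial (Fin 2) ℂ)
    (hndG : NonDegenerateDual p q G)
    (hsuppG : ∀ m ∈ G.support,
      0 ≤ (p : ℤ) * (m 0 : ℤ) - (q : ℤ) * (m 1 : ℤ) ∧ m ≠ 0) :
    ((∃ m ∈ G.support, m 1 = 0) ∧
      (∃ m ∈ G.support, ∃ k : ℕ, m 0 = k * q ∧ m 1 = k * p))
    ↔ ∃ ε > (0 : ℝ),
        (∀ t₁ t₂ : ℂ, t₁ ≠ 0 → t₂ ≠ 0 →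
          ‖(fun k : Fin n =>
              t₁ ^ (μ ((k : ℕ) + 1)).1.toNat * t₂ ^ (μ ((k : ℕ) + 1)).2.toNat :
            Fin n → ℂ)‖ < ε →
          ¬ (eval ![t₁, t₂] (pderiv 0 G) = 0 ∧ eval ![t₁, t₂] (pderiv 1 G) = 0)) ∧
        (∀ t : ℂ, t ≠ 0 → ‖t‖ < ε →
          deriv (fun z : ℂ => eval ![z, (0 : ℂ)] G) t ≠ 0) ∧
        (∀ s : ℂ, s ≠ 0 → ‖s‖ < ε →
          deriv (fun z : ℂ => ∑ k ∈ Finset.Icc 1 G.totalDegree,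
            coeff (Finsupp.single (0 : Fin 2) (k * q) +
              Finsupp.single (1 : Fin 2) (k * p)) G * z ^ k) s ≠ 0) := by
  have hp : 0 < p := hq.trans hqp
  have hlast := last_generator_eq p q hqp hcop n hn a ha hHJ μ hμ1 hμ2 hrec
  set c : ℕ → ℂ := fun k => coeff (Finsupp.single (0 : Fin 2) (k * q) +
    Finsupp.single (1 : Fin 2) (k * p)) G with hc
  have hray : ∀ (m : Fin 2 →₀ ℕ) (k : ℕ), m 0 = k * q → m 1 = k * p →
      Finsupp.single (0 : Fin 2) (k * q) + Finsupp.single (1 : Fin 2) (k * p) = m := by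
    intro m k h0 h1
    ext i
    fin_cases i <;> simp [h0, h1]
  constructor
  · rintro ⟨⟨m, hm, hm1⟩, m', hm', k, hk0, hk1⟩
    have hm0 : m 0 ≠ 0 := fun h => (hsuppG m hm).2 (by
      ext i
      fin_cases i
      · exact h
      · exact hm1)
    have hk : k ≠ 0 := by
      rintro rfl
      refine (hsuppG m' hm').2 ?_
      ext i
      fin_cases i
      · simpa using hk0
      · simpa using hk1
    obtain ⟨ε₁, hε₁, hb⟩ := exists_pos_forall_deriv_ne_zero
      (aeval ![Polynomial.X, (0 : Polynomial ℂ)] G) (m 0) hm0 (by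
        rw [coeff_aeval_X_zero m hm1]
        exact mem_support_iff.1 hm)
    obtain ⟨ε₂, hε₂, hc'⟩ := exists_pos_forall_deriv_ne_zero
      (∑ j ∈ Finset.Icc 1 G.totalDegree, Polynomial.monomial j (c j)) k hk (by
        have hdeg : k ≤ G.totalDegree := by
          have h := le_totalDegree hm'
          rw [Finsupp.sum_fintype _ _ (by simp), Fin.sum_univ_two, hk0] at h
          nlinarith
        simp only [Polynomial.finsetSum_coeff, Polynomial.coeff_monomial, Finset.sum_ite_eq',
          Finset.mem_Icc]
        rw [if_pos ⟨by omega, hdeg⟩, hc]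
        simp only [hray m' k hk0 hk1]
        exact mem_support_iff.1 hm')
    obtain ⟨ε₃, hε₃, ha'⟩ : ∃ ε > (0 : ℝ), ∀ t₁ t₂ : ℂ, t₁ ≠ 0 → t₂ ≠ 0 → ‖t₁‖ < ε →
        ‖t₁ ^ q * t₂ ^ p‖ < ε →
        ¬ (eval ![t₁, t₂] (pderiv 0 G) = 0 ∧ eval ![t₁, t₂] (pderiv 1 G) = 0) := by
      by_contra! h
      choose s t hs ht hs0 hst0 h0 h1 using
        fun j : ℕ => h (1 / ((j : ℝ) + 1)) Nat.one_div_pos_of_nat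
      have hle : ((Filter.hyperfilter ℕ : Ultrafilter ℕ) : Filter ℕ) ≤ Filter.atTop :=
        Nat.cofinite_eq_atTop ▸ Filter.hyperfilter_le_cofinite
      have hG0 := hndG.eq_zero_of_tendsto_critical hp hsuppG (Filter.hyperfilter ℕ) s t hs ht
        ((squeeze_zero_norm (fun j => (hs0 j).le)
          tendsto_one_div_add_atTop_nhds_zero_nat).mono_left hle)
        ((squeeze_zero_norm (fun j => (hst0 j).le)
          tendsto_one_div_add_atTop_nhds_zero_nat).mono_left hle)
        (fun j i => by
          fin_cases i
          · exact h0 j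
          · exact h1 j)
      simp [hG0] at hm
    refine ⟨min ε₃ (min ε₁ ε₂), by positivity, fun t₁ t₂ h1 h2 hlt => ?_, fun t h hlt => ?_,
      fun s h hlt => ?_⟩
    · have hlt' := hlt.trans_le (min_le_left _ _)
      refine ha' t₁ t₂ h1 h2 ?_ ?_
      · have := (norm_le_pi_norm (fun k : Fin n =>
          t₁ ^ (μ ((k : ℕ) + 1)).1.toNat * t₂ ^ (μ ((k : ℕ) + 1)).2.toNat)
            ⟨0, by omega⟩).trans_lt hlt'
        simpa [hμ1] using this
      · have := (norm_le_pi_norm (fun k : Fin n =>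
          t₁ ^ (μ ((k : ℕ) + 1)).1.toNat * t₂ ^ (μ ((k : ℕ) + 1)).2.toNat)
            ⟨n - 1, by omega⟩).trans_lt hlt'
        simpa [show n - 1 + 1 = n by omega, hlast] using this
    · have h3 := hb t h (hlt.trans_le ((min_le_right _ _).trans (min_le_left _ _)))
      simpa only [eval_aeval_X_zero] using h3
    · have h3 := hc' s h (hlt.trans_le ((min_le_right _ _).trans (min_le_right _ _)))
      simpa only [Polynomial.eval_finsetSum, Polynomial.eval_monomial] using h3
  · rintro ⟨ε, hε, -, hb, hc'⟩
    have hhalf : ((ε / 2 : ℝ) : ℂ) ≠ 0 := by exact_mod_cast (half_pos hε).ne'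
    have hnorm : ‖((ε / 2 : ℝ) : ℂ)‖ < ε := by
      rw [Complex.norm_real, Real.norm_of_nonneg (half_pos hε).le]
      exact half_lt_self hε
    constructor
    · by_contra! h
      refine hb _ hhalf hnorm ?_
      have hz : (fun z : ℂ => eval ![z, (0 : ℂ)] G) = fun _ => 0 := by
        funext z
        rw [eval_eq']
        refine Finset.sum_eq_zero fun m hm => ?_
        simp [Fin.prod_univ_two, h m hm]
      rw [hz, deriv_const]
    · by_contra! h
      refine hc' _ hhalf hnorm ?_
      have hz : (fun z : ℂ => ∑ k ∈ Finset.Icc 1 G.totalDegree, c k * z ^ k) = fun _ => 0 := by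
        funext z
        refine Finset.sum_eq_zero fun k _ => ?_
        have : c k = 0 := by
          by_contra hne
          exact h _ (mem_support_iff.2 hne) k (by simp) (by simp)
        rw [this, zero_mul]
      rw [hz, deriv_const]

end
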